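/- Let n be a positive integer with n ≥ 83, n ≡ 4 (mod 5) and n ≡ 1 (mod 6). Then for every finite abelian group H of order n²+n+1 there exist no inverse-closed subsets T₀, T₁ of H with e ∈ T₀ satisfying the APLL group-ring equations. -/

import Mathlib

open scoped Classical Pointwise

/-- The APLL group-ring equations, stated via coefficient counts: for every `h ∈ H`,
`#{(a,b) ∈ T₀×T₁ : ab = h} = 1 − [h = e]`, and
`#{(a,b) ∈ T₀×T₀ : ab = h} + #{(a,b) ∈ T₁×T₁ : ab = h} + #{t ∈ T₀ : t² = h}
  + #{t ∈ T₁ : t² = h} = 2 + 2n·[h = e]`. -/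
def APLLEqs {H : Type*} [CommGroup H] (n : ℕ) (T₀ T₁ : Set H) : Prop :=
  (∀ h : H,
      {p : H × H | p.1 ∈ T₀ ∧ p.2 ∈ T₁ ∧ p.1 * p.2 = h}.ncard
        = if h = 1 then 0 else 1) ∧
  (∀ h : H,
      {p : H × H | p.1 ∈ T₀ ∧ p.2 ∈ T₀ ∧ p.1 * p.2 = h}.ncard
        + {p : H × H | p.1 ∈ T₁ ∧ p.2 ∈ T₁ ∧ p.1 * p.2 = h}.ncard
        + {t : H | t ∈ T₀ ∧ t ^ 2 = h}.ncard
        + {t : H | t ∈ T₁ ∧ t ^ 2 = h}.ncard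
        = 2 + if h = 1 then 2 * n else 0)

/-- `Xset T₀ T₁ i` is the set of `h ∈ H` appearing with coefficient `i` in `T̂⁽²⁾T₀`. -/
def Xset {H : Type*} [CommGroup H] (T₀ T₁ : Set H) (i : ℕ) : Set H :=
  {h : H | {p : H × H | p.1 ∈ T₀ ∪ T₁ ∧ p.2 ∈ T₀ ∧ p.1 ^ 2 * p.2 = h}.ncard = i}

/-- `Yset T₀ T₁ i` is the set of `h ∈ H` appearing with coefficient `i` in `T̂⁽²⁾T₁`. -/
def Yset {H : Type*} [CommGroup H] (T₀ T₁ : Set H) (i : ℕ) : Set H :=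
  {h : H | {p : H × H | p.1 ∈ T₀ ∪ T₁ ∧ p.2 ∈ T₁ ∧ p.1 ^ 2 * p.2 = h}.ncard = i}

/-- `Vset T₀ T₁ i` is the set of `h ∈ H` appearing with coefficient `i` in `T̂⁽⁴⁾T₁`. -/
def Vset {H : Type*} [CommGroup H] (T₀ T₁ : Set H) (i : ℕ) : Set H :=
  {h : H | {p : H × H | p.1 ∈ T₀ ∪ T₁ ∧ p.2 ∈ T₁ ∧ p.1 ^ 4 * p.2 = h}.ncard = i}

/-- `θ₀ = |(T₀T₀ ∖ T₀⁽²⁾) ∩ T̂⁽⁴⁾|`. -/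
noncomputable def theta0 {H : Type*} [CommGroup H] (T₀ T₁ : Set H) : ℕ :=
  (((T₀ * T₀) \ ((fun t => t ^ 2) '' T₀)) ∩ ((fun g => g ^ 4) '' (T₀ ∪ T₁))).ncard

/-- `θ₁ = |T₁ ∩ T̂⁽²⁾|/2 + |(T₁T₁ ∖ (T₁⁽²⁾ ∪ {e})) ∩ T̂⁽⁴⁾|`, as a rational number. -/
noncomputable def theta1 {H : Type*} [CommGroup H] (T₀ T₁ : Set H) : ℚ :=
  ((T₁ ∩ ((fun g => g ^ 2) '' (T₀ ∪ T₁))).ncard : ℚ) / 2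
    + ((((T₁ * T₁) \ (((fun t => t ^ 2) '' T₁) ∪ {1}))
        ∩ ((fun g => g ^ 4) '' (T₀ ∪ T₁))).ncard : ℚ)

/-- `s_i = (i−1)(i−4)/2` if `i ≡ 1 (mod 3)`, and `(i−2)(i−3)/2` otherwise. -/
def sCoef (i : ℕ) : ℚ :=
  if i % 3 = 1 then ((i : ℚ) - 1) * ((i : ℚ) - 4) / 2
  else ((i : ℚ) - 2) * ((i : ℚ) - 3) / 2

section CubicCharacter

variable {H : Type*} [CommGroup H] [Fintype H]

theorem exists_cubic_character (h3 : 3 ∣ Fintype.card H) :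
    ∃ χ : H →* ℂˣ, χ ≠ 1 ∧ ∀ h, χ h ^ 3 = 1 := by
  obtain ⟨e⟩ := CommGroup.monoidHom_mulEquiv_of_hasEnoughRootsOfUnity H ℂ
  have : Fact (Nat.Prime 3) := ⟨Nat.prime_three⟩
  obtain ⟨g, hg⟩ := exists_prime_orderOf_dvd_card 3 h3
  have horder : orderOf (e.symm g) = 3 := by rw [MulEquiv.orderOf_eq, hg]
  refine ⟨e.symm g, fun h => ?_, fun h => ?_⟩
  · simp [h] at horder
  · rw [← MonoidHom.pow_apply, ← horder, pow_orderOf_eq_one, MonoidHom.one_apply]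

theorem sum_mul_ncard_fiber {α M : Type*} [Fintype α] [Fintype M] (P : Set α) (g : α → M)
    (f : M → ℂ) :
    ∑ h, f h * ({p | p ∈ P ∧ g p = h}.ncard : ℂ) = ∑ p ∈ P.toFinset, f (g p) := by
  rw [← Finset.sum_fiberwise P.toFinset g]
  refine Finset.sum_congr rfl fun h _ => ?_
  have hset : {p | p ∈ P ∧ g p = h} = ({p ∈ P.toFinset | g p = h} : Finset α) := by
    ext; simp
  rw [hset, Set.ncard_coe_finset, Finset.sum_congr rfl fun p hp => by
    rw [(Finset.mem_filter.1 hp).2], Finset.sum_const, nsmul_eq_mul, mul_comm]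

theorem sum_mul_ncard_mul_eq (χ : H →* ℂˣ) (S T : Set H) :
    ∑ h, (χ h : ℂ) * ({p : H × H | p.1 ∈ S ∧ p.2 ∈ T ∧ p.1 * p.2 = h}.ncard : ℂ)
      = (∑ s ∈ S.toFinset, (χ s : ℂ)) * ∑ t ∈ T.toFinset, (χ t : ℂ) := by
  have := sum_mul_ncard_fiber (S ×ˢ T) (fun p : H × H => p.1 * p.2) (fun h => (χ h : ℂ))
  simp only [Set.mem_prod, and_assoc] at this
  rw [this, Set.toFinset_prod, Finset.sum_product, Finset.sum_mul_sum]
  simp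

theorem sum_toFinset_inv {T : Set H} (hT : T⁻¹ = T) (f : H → ℂ) :
    ∑ t ∈ T.toFinset, f t⁻¹ = ∑ t ∈ T.toFinset, f t := by
  have hmem : ∀ t, t⁻¹ ∈ T ↔ t ∈ T := fun t => by rw [← Set.mem_inv, hT]
  exact Finset.sum_equiv (Equiv.inv H) (by simp [hmem]) (by simp)

theorem sum_mul_ncard_sq_eq {χ : H →* ℂˣ} (hχ : ∀ h, χ h ^ 3 = 1) {T : Set H}
    (hT : T⁻¹ = T) :
    ∑ h, (χ h : ℂ) * ({t : H | t ∈ T ∧ t ^ 2 = h}.ncard : ℂ)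
      = ∑ t ∈ T.toFinset, (χ t : ℂ) := by
  rw [sum_mul_ncard_fiber T (fun t => t ^ 2) (fun h => (χ h : ℂ)), ← sum_toFinset_inv hT]
  refine Finset.sum_congr rfl fun t _ => ?_
  congr 1
  rw [map_pow, map_inv, inv_pow, inv_eq_iff_mul_eq_one, ← pow_succ, hχ]

/-- For an inverse-closed set, twice the sum of the values of a cubic character is a sum of the
integers `χ t + (χ t)⁻¹`. -/
theorem exists_int_eq_two_mul_sum {χ : H →* ℂˣ} (hχ : ∀ h, χ h ^ 3 = 1) {T : Set H}
    (hT : T⁻¹ = T) : ∃ a : ℤ, (a : ℂ) = 2 * ∑ t ∈ T.toFinset, (χ t : ℂ) := by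
  have hint : ∀ t, ∃ a : ℤ, (a : ℂ) = χ t + χ t⁻¹ := by
    intro t
    have hcube : (χ t : ℂ) ^ 3 = 1 := by
      rw [← Units.val_pow_eq_pow_val, hχ, Units.val_one]
    have hinv : (χ t⁻¹ : ℂ) = (χ t : ℂ) ^ 2 := by
      rw [map_inv, ← Units.val_pow_eq_pow_val, inv_eq_of_mul_eq_one_right]
      rw [← pow_succ', hχ]
    rw [hinv]
    have hfac : ((χ t : ℂ) - 1) * ((χ t : ℂ) + (χ t : ℂ) ^ 2 + 1) = 0 := by
      linear_combination hcube
    rcases mul_eq_zero.1 hfac with h | h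
    · exact ⟨2, by rw [sub_eq_zero.1 h]; norm_num⟩
    · exact ⟨-1, by push_cast; linear_combination -h⟩
  choose a ha using hint
  refine ⟨∑ t ∈ T.toFinset, a t, ?_⟩
  push_cast
  simp only [ha, Finset.sum_add_distrib]
  rw [sum_toFinset_inv hT (fun t => (χ t : ℂ)), two_mul]

end CubicCharacter

/-- Nonexistence of inverse-closed subsets `T₀, T₁` with `e ∈ T₀` satisfying the
APLL group-ring equations, in any finite abelian group of order `n²+n+1`. -/
theorem no_APLL_subsets_ge83_4mod5_1mod6 (n : ℕ) (hn : 0 < n)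
    (hge : 83 ≤ n) (h5 : n % 5 = 4) (h6 : n % 6 = 1)
    (H : Type*) [CommGroup H] [Fintype H]
    (hcard : Fintype.card H = n ^ 2 + n + 1) :
    ¬ ∃ T₀ T₁ : Set H,
        T₀⁻¹ = T₀ ∧ T₁⁻¹ = T₁ ∧ (1 : H) ∈ T₀ ∧ APLLEqs n T₀ T₁ := by
  rintro ⟨T₀, T₁, hT₀, hT₁, -, hprod, hsq⟩
  have h3 : 3 ∣ Fintype.card H := by
    rw [hcard, Nat.dvd_iff_mod_eq_zero, Nat.add_mod, Nat.add_mod (n ^ 2), Nat.pow_mod,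
      show n % 3 = 1 by omega]
  obtain ⟨χ, hχ, hχ3⟩ := exists_cubic_character h3
  obtain ⟨a, ha⟩ := exists_int_eq_two_mul_sum hχ3 hT₀
  obtain ⟨b, hb⟩ := exists_int_eq_two_mul_sum hχ3 hT₁
  set x : ℂ := ∑ t ∈ T₀.toFinset, (χ t : ℂ) with hx
  set y : ℂ := ∑ t ∈ T₁.toFinset, (χ t : ℂ) with hy
  have hsum : ∑ h : H, (χ h : ℂ) = 0 :=
    sum_hom_units_eq_zero ((Units.coeHom ℂ).comp χ) fun h =>
      hχ (MonoidHom.ext fun g => Units.ext (DFunLike.congr_fun h g))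
  have hxy : x * y = -1 := by
    rw [hx, hy, ← sum_mul_ncard_mul_eq]
    simp only [hprod]
    have key : ∀ h : H, (χ h : ℂ) * ((if h = 1 then 0 else 1 : ℕ) : ℂ)
        = χ h - if h = 1 then 1 else 0 := by
      intro h; split_ifs with hh <;> simp [hh]
    simp only [key, Finset.sum_sub_distrib, hsum]
    simp
  have hxy2 : x * x + y * y + x + y = 2 * n := by
    have e₀ := sum_mul_ncard_sq_eq hχ3 hT₀
    have e₁ := sum_mul_ncard_sq_eq hχ3 hT₁
    rw [hx, hy, ← sum_mul_ncard_mul_eq, ← sum_mul_ncard_mul_eq, ← e₀, ← e₁,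
      ← Finset.sum_add_distrib, ← Finset.sum_add_distrib, ← Finset.sum_add_distrib]
    have key : ∀ h : H, (χ h : ℂ) * ((2 + if h = 1 then 2 * n else 0 : ℕ) : ℂ)
        = 2 * χ h + if h = 1 then 2 * (n : ℂ) else 0 := by
      intro h; split_ifs with hh <;> simp [hh, mul_comm]
    simp only [← mul_add, ← Nat.cast_add, hsq, key]
    rw [Finset.sum_add_distrib, ← Finset.mul_sum, hsum]
    simp
  have hab : a * b = -4 := by
    have : (a * b : ℂ) = -4 := by rw [ha, hb]; linear_combination 4 * hxy
    exact_mod_cast this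
  have hab2 : a * a + b * b + 2 * a + 2 * b = 8 * n := by
    have : (a * a + b * b + 2 * a + 2 * b : ℂ) = 8 * n := by
      rw [ha, hb]; linear_combination 4 * hxy2
    exact_mod_cast this
  have habs : ∀ c : ℤ, c ∣ 4 → |c| ≤ 4 := fun c hc =>
    Int.le_of_dvd (by norm_num) ((abs_dvd c 4).2 hc)
  have ha4 := abs_le.1 (habs a ⟨-b, by linarith⟩)
  have hb4 := abs_le.1 (habs b ⟨-a, by linarith⟩)
  have hn83 : (83 : ℤ) ≤ n := by exact_mod_cast hge
  nlinarith
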